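/- arXiv:2006.08188 — 2 statements merged into one kernel-verified Lean document; each statement's English description precedes it below -/
import Mathlib

section
/- Let A ∈ ℝ^{m×n}, b ∈ ℝᵐ, λ > 0 and μ > 0. For z ∈ ℝᵐ define g(z) = sup_{x∈ℝⁿ} ( −μ‖x‖₁ − (λ/2)‖x‖² − ⟨Aᵀz, x⟩ ). Then g(z) is finite for every z ∈ ℝᵐ, and the dual objective h(z) = (1/2)‖z‖² + ⟨b, z⟩ + g(z) is strongly convex on ℝᵐ with parameter 1: for all z, z' ∈ ℝᵐ and t ∈ [0,1], h(tz + (1−t)z') ≤ t·h(z) + (1−t)·h(z') − (1/2)·t(1−t)‖z − z'‖². -/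
open scoped Matrix RealInnerProductSpace

/-- For the elastic net dual: with `g(z) = sup_x ( −μ‖x‖₁ − (λ/2)‖x‖² − ⟨Aᵀz, x⟩ )`,
the value `g(z)` is finite (the set of values is bounded above; it is obviously nonempty)
for every `z ∈ ℝᵐ`, and the dual objective `h(z) = (1/2)‖z‖² + ⟨b,z⟩ + g(z)` is strongly
convex with parameter `1`. -/
theorem dual_objective_strongly_convex {m n : ℕ} (A : Matrix (Fin m) (Fin n) ℝ)
    (b : EuclideanSpace ℝ (Fin m)) (lam μ : ℝ) (hlam : 0 < lam) (hμ : 0 < μ)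
    (S : EuclideanSpace ℝ (Fin m) → Set ℝ)
    (hS : ∀ z, S z = {v : ℝ | ∃ x : EuclideanSpace ℝ (Fin n),
      v = -(μ * ∑ i, |x i|) - (lam / 2) * ‖x‖ ^ 2 - ⟪Matrix.toEuclideanLin Aᵀ z, x⟫})
    (h : EuclideanSpace ℝ (Fin m) → ℝ)
    (hh : ∀ z, h z = (1 / 2) * ‖z‖ ^ 2 + ⟪b, z⟫ + sSup (S z)) :
    (∀ z, BddAbove (S z)) ∧
    ∀ z z' : EuclideanSpace ℝ (Fin m), ∀ t : ℝ, 0 ≤ t → t ≤ 1 →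
      h (t • z + (1 - t) • z') ≤
        t * h z + (1 - t) * h z' - (1 / 2) * t * (1 - t) * ‖z - z'‖ ^ 2 := by
  have hb : ∀ z, BddAbove (S z) := by
    intro z
    rw [hS z]
    refine ⟨‖Matrix.toEuclideanLin Aᵀ z‖ ^ 2 / (2 * lam), ?_⟩
    rintro v ⟨x, rfl⟩
    generalize Matrix.toEuclideanLin Aᵀ z = w
    have h1 : 0 ≤ μ * ∑ i, |x i| :=
      mul_nonneg hμ.le (Finset.sum_nonneg fun i _ => abs_nonneg _)
    have h2 := neg_le_of_abs_le (abs_real_inner_le_norm w x)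
    have h3 : ‖w‖ * ‖x‖ ≤ ‖w‖ ^ 2 / (2 * lam) + (lam / 2) * ‖x‖ ^ 2 := by
      have h4 : ‖w‖ ^ 2 / (2 * lam) + (lam / 2) * ‖x‖ ^ 2 - ‖w‖ * ‖x‖
          = (‖w‖ - lam * ‖x‖) ^ 2 / (2 * lam) := by
        field_simp
        ring
      have h5 : 0 ≤ (‖w‖ - lam * ‖x‖) ^ 2 / (2 * lam) := by positivity
      linarith
    linarith
  refine ⟨hb, ?_⟩
  intro z z' t ht0 ht1
  have hs : 0 ≤ 1 - t := by linarith
  have hg : sSup (S (t • z + (1 - t) • z')) ≤ t * sSup (S z) + (1 - t) * sSup (S z') := by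
    apply csSup_le
    · rw [hS]
      exact ⟨_, 0, rfl⟩
    · intro v hv
      rw [hS] at hv
      obtain ⟨x, rfl⟩ := hv
      have e1 := le_csSup (hb z) (by rw [hS z]; exact ⟨x, rfl⟩)
      have e2 := le_csSup (hb z') (by rw [hS z']; exact ⟨x, rfl⟩)
      have e3 := mul_le_mul_of_nonneg_left e1 ht0
      have e4 := mul_le_mul_of_nonneg_left e2 hs
      rw [map_add, map_smul, map_smul, inner_add_left, real_inner_smul_left,
        real_inner_smul_left]
      linarith
  have hq : ‖t • z + (1 - t) • z'‖ ^ 2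
      = t * ‖z‖ ^ 2 + (1 - t) * ‖z'‖ ^ 2 - t * (1 - t) * ‖z - z'‖ ^ 2 := by
    rw [norm_add_sq_real, norm_sub_sq_real, norm_smul, norm_smul, real_inner_smul_left,
      real_inner_smul_right, Real.norm_of_nonneg ht0, Real.norm_of_nonneg hs]
    ring
  rw [hh, hh, hh, hq, inner_add_right, real_inner_smul_right, real_inner_smul_right]
  linarith
end

section
/- Let A ∈ ℝ^{m×n}, b ∈ ℝᵐ, λ > 0, and let φ : ℝⁿ → ℝ be a convex continuous function. Suppose z* ∈ ℝᵐ and x* ∈ ℝⁿ are such that x* minimizes the function x ↦ λ⁻¹φ(x) + (1/2)‖x + λ⁻¹Aᵀz*‖² over ℝⁿ and Ax* − b = z*. Then x* minimizes f(x) = (1/2)‖Ax − b‖² + (λ/2)‖x‖² + φ(x) over ℝⁿ. -/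
open scoped Matrix

/-- Primal recovery from the dual solution: if `x*` minimizes
`x ↦ λ⁻¹φ(x) + (1/2)‖x + λ⁻¹Aᵀz*‖²` (i.e. `x* = Prox_{λ⁻¹φ}(−λ⁻¹Aᵀz*)`) and
`Ax* − b = z*`, then `x*` minimizes `f(x) = (1/2)‖Ax − b‖² + (λ/2)‖x‖² + φ(x)`. -/
theorem primal_recovery_from_dual {m n : ℕ} (A : Matrix (Fin m) (Fin n) ℝ)
    (b : EuclideanSpace ℝ (Fin m)) (lam : ℝ) (hlam : 0 < lam)
    (φ : EuclideanSpace ℝ (Fin n) → ℝ) (hφ : ConvexOn ℝ Set.univ φ)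
    (hφc : Continuous φ)
    (f : EuclideanSpace ℝ (Fin n) → ℝ)
    (hf : ∀ x, f x = (1 / 2) * ‖Matrix.toEuclideanLin A x - b‖ ^ 2
      + (lam / 2) * ‖x‖ ^ 2 + φ x)
    (zs : EuclideanSpace ℝ (Fin m)) (xs : EuclideanSpace ℝ (Fin n))
    (hxs : ∀ x : EuclideanSpace ℝ (Fin n),
      lam⁻¹ * φ xs + (1 / 2) * ‖xs + lam⁻¹ • Matrix.toEuclideanLin Aᵀ zs‖ ^ 2 ≤
        lam⁻¹ * φ x + (1 / 2) * ‖x + lam⁻¹ • Matrix.toEuclideanLin Aᵀ zs‖ ^ 2)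
    (hz : Matrix.toEuclideanLin A xs - b = zs) :
    ∀ x, f xs ≤ f x := by
  intro x
  have hadj : ∀ y : EuclideanSpace ℝ (Fin n),
      inner ℝ y (Matrix.toEuclideanLin Aᵀ zs) = inner ℝ (Matrix.toEuclideanLin A y) zs := by
    intro y
    have h : Aᵀ = Aᴴ := by
      ext i j
      simp [Matrix.conjTranspose_apply]
    rw [h, Matrix.toEuclideanLin_conjTranspose_eq_adjoint, LinearMap.adjoint_inner_right]
  have key : ∀ y : EuclideanSpace ℝ (Fin n),
      lam * (lam⁻¹ * φ y + (1 / 2) * ‖y + lam⁻¹ • Matrix.toEuclideanLin Aᵀ zs‖ ^ 2) =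
        φ y + (lam / 2) * ‖y‖ ^ 2 + inner ℝ (Matrix.toEuclideanLin A y) zs
          + (lam / 2) * ‖lam⁻¹ • Matrix.toEuclideanLin Aᵀ zs‖ ^ 2 := by
    intro y
    rw [norm_add_sq_real, inner_smul_right, hadj]
    field_simp
    ring
  have h1 := mul_le_mul_of_nonneg_left (hxs x) hlam.le
  rw [key, key] at h1
  have h2 : Matrix.toEuclideanLin A x - b
      = zs + (Matrix.toEuclideanLin A x - Matrix.toEuclideanLin A xs) := by
    rw [← hz]; abel
  have h3 := norm_add_sq_real zs (Matrix.toEuclideanLin A x - Matrix.toEuclideanLin A xs)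
  rw [inner_sub_right, real_inner_comm, real_inner_comm (Matrix.toEuclideanLin A xs)] at h3
  rw [hf, hf, hz, h2, h3]
  nlinarith [sq_nonneg ‖Matrix.toEuclideanLin A x - Matrix.toEuclideanLin A xs‖]
end
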